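/- arXiv:1606.09164 — 5 statements merged into one kernel-verified Lean document; each statement's English description precedes it below -/
import Mathlib

section
/- For every prime p, λ(p) ≥ δ(p); in particular λ(p) ≥ 0, where δ(p) is the minimum of ord_p(α_i) over the nonzero coefficients α_i of f. -/
open Polynomial

/-- `λ_i(p) = ord_p(f'(γ_i))`, where `f'` is the derivative of `f` and `γ_i` is the `i`-th
rational root of `f`. -/
noncomputable def lamI (f : Polynomial ℤ) {d : ℕ} (γ : Fin d → ℚ) (i : Fin d) (p : ℕ) : ℤ :=
  padicValRat p (((f.map (Int.castRingHom ℚ)).derivative).eval (γ i))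

/-- `λ(p) = max_{1 ≤ i ≤ d} λ_i(p)`. -/
noncomputable def lam (f : Polynomial ℤ) {d : ℕ} (hd : 1 ≤ d) (γ : Fin d → ℚ) (p : ℕ) : ℤ :=
  Finset.univ.sup' ⟨⟨0, hd⟩, Finset.mem_univ _⟩ fun i => lamI f γ i p

/-- The `p`-adic norm of `f'(x)` is bounded by that of the coefficients of `f` when `x` is
`p`-integral. -/
theorem padicNorm_eval_derivative_le {p : ℕ} [Fact p.Prime] {f : ℤ[X]} {B : ℚ}
    (hB : ∀ k, padicNorm p (f.coeff k) ≤ B) {x : ℚ} (hx : padicNorm p x ≤ 1) :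
    padicNorm p ((f.map (Int.castRingHom ℚ)).derivative.eval x) ≤ B := by
  have hB0 : 0 ≤ B := (padicNorm.nonneg _).trans (hB 0)
  rw [eval_eq_sum, sum_def]
  refine padicNorm.sum_le' (fun k _ => ?_) hB0
  rw [coeff_derivative, coeff_map, padicNorm.mul, padicNorm.mul, eq_intCast]
  have hk : padicNorm p ((k : ℚ) + 1) ≤ 1 := by
    exact_mod_cast padicNorm.of_nat (p := p) (k + 1)
  have hxk : padicNorm p (x ^ k) ≤ 1 := by
    rw [IsAbsoluteValue.abv_pow (padicNorm p)]
    exact pow_le_one₀ (padicNorm.nonneg _) hx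
  calc _ ≤ B * 1 * 1 := by
        gcongr
        exacts [padicNorm.nonneg _, padicNorm.nonneg _, hB _]
    _ = B := by ring

theorem eval_derivative_C_mul_prod_X_sub_C {R ι : Type*} [CommRing R] [DecidableEq ι]
    (s : Finset ι) (a : R) (γ : ι → R) {i : ι} (hi : i ∈ s) :
    (C a * ∏ j ∈ s, (X - C (γ j))).derivative.eval (γ i) =
      a * ∏ j ∈ s.erase i, (γ i - γ j) := by
  rw [← Finset.mul_prod_erase s _ hi]
  simp [eval_prod]

/-- At a root of smallest `p`-adic norm which is not `p`-integral, the derivative is bounded by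
the constant coefficient. -/
theorem padicNorm_mul_prod_sub_le {p : ℕ} [Fact p.Prime] {ι : Type*} [DecidableEq ι]
    (s : Finset ι) (a : ℚ) (γ : ι → ℚ) {i : ι} (hi : i ∈ s)
    (hmin : ∀ j ∈ s, padicNorm p (γ i) ≤ padicNorm p (γ j)) (h1 : 1 ≤ padicNorm p (γ i)) :
    padicNorm p (a * ∏ j ∈ s.erase i, (γ i - γ j)) ≤ padicNorm p (a * ∏ j ∈ s, -γ j) := by
  have hprod : ∀ (t : Finset ι) (g : ι → ℚ),
      padicNorm p (∏ j ∈ t, g j) = ∏ j ∈ t, padicNorm p (g j) := fun t g =>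
    map_prod (IsAbsoluteValue.abvHom (padicNorm p)) g t
  rw [padicNorm.mul, padicNorm.mul, hprod, hprod, ← Finset.mul_prod_erase s _ hi, padicNorm.neg]
  refine mul_le_mul_of_nonneg_left ?_ (padicNorm.nonneg _)
  have hle : ∏ j ∈ s.erase i, padicNorm p (γ i - γ j) ≤ ∏ j ∈ s.erase i, padicNorm p (-γ j) := by
    refine Finset.prod_le_prod (fun j _ => padicNorm.nonneg _) fun j hj => ?_
    rw [padicNorm.neg]
    exact padicNorm.sub.trans (max_le (hmin j (Finset.mem_of_mem_erase hj)) le_rfl)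
  exact hle.trans (le_mul_of_one_le_left (Finset.prod_nonneg fun j _ => padicNorm.nonneg _) h1)

/-- Let `f = α_d T^d + ⋯ + α_0 ∈ ℤ[T]` be separable of degree `d ≥ 1` with all
roots `γ_1, …, γ_d` rational. For every prime `p`, `λ(p) ≥ δ(p)`, where `δ(p)` is the minimum
of `ord_p` over the nonzero coefficients of `f`; in particular `λ(p) ≥ 0`. -/
theorem lam_ge_delta
    (f : Polynomial ℤ) (d : ℕ) (hd : 1 ≤ d) (hdeg : f.natDegree = d) (hf0 : f ≠ 0)
    (hsep : Squarefree (f.map (Int.castRingHom ℚ)))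
    (γ : Fin d → ℚ)
    (hfac : f.map (Int.castRingHom ℚ) =
      Polynomial.C ((f.leadingCoeff : ℚ)) * ∏ i : Fin d, (Polynomial.X - Polynomial.C (γ i)))
    (p : ℕ) (hp : p.Prime) :
    (f.support.inf' (Polynomial.support_nonempty.mpr hf0)
        fun i => padicValRat p ((f.coeff i : ℚ))) ≤ lam f hd γ p ∧
      0 ≤ lam f hd γ p := by
  have := Fact.mk hp
  have hp1 : (1 : ℚ) < p := by exact_mod_cast hp.one_lt
  set δ := f.support.inf' (support_nonempty.mpr hf0)
    fun i => padicValRat p ((f.coeff i : ℚ))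
  have hδ0 : 0 ≤ δ := Finset.le_inf' _ _ fun k _ => by
    rw [padicValRat.of_int]
    exact Int.natCast_nonneg _
  suffices h : δ ≤ lam f hd γ p from ⟨h, hδ0.trans h⟩
  have hB : ∀ k, padicNorm p (f.coeff k) ≤ (p : ℚ) ^ (-δ) := fun k => by
    by_cases hk : f.coeff k = 0
    · rw [hk, Int.cast_zero, padicNorm.zero]
      positivity
    · rw [padicNorm.eq_zpow_of_nonzero (Int.cast_ne_zero.mpr hk)]
      exact zpow_le_zpow_right₀ hp1.le (neg_le_neg (Finset.inf'_le _ (mem_support_iff.mpr hk)))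
  obtain ⟨i, -, hmin⟩ := Finset.exists_min_image Finset.univ (fun j => padicNorm p (γ j))
    ⟨⟨0, hd⟩, Finset.mem_univ _⟩
  have hnorm : padicNorm p ((f.map (Int.castRingHom ℚ)).derivative.eval (γ i)) ≤
      (p : ℚ) ^ (-δ) := by
    rcases le_total (padicNorm p (γ i)) 1 with h1 | h1
    · exact padicNorm_eval_derivative_le hB h1
    · have h0 : (f.coeff 0 : ℚ) = f.leadingCoeff * ∏ j, -γ j := by
        simpa [eval_prod, coeff_zero_eq_eval_zero] using congrArg (fun g => g.coeff 0) hfac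
      rw [hfac, eval_derivative_C_mul_prod_X_sub_C _ _ _ (Finset.mem_univ i)]
      refine (padicNorm_mul_prod_sub_le _ _ _ (Finset.mem_univ i) hmin h1).trans ?_
      rw [← h0]
      exact hB 0
  have hroot : (f.map (Int.castRingHom ℚ)).eval (γ i) = 0 := by
    rw [hfac, eval_mul, eval_prod, Finset.prod_eq_zero (Finset.mem_univ i) (by simp), mul_zero]
  have hne : (f.map (Int.castRingHom ℚ)).derivative.eval (γ i) ≠ 0 :=
    (PerfectField.separable_iff_squarefree.mpr hsep).eval₂_derivative_ne_zero (RingHom.id ℚ) hroot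
  rw [padicNorm.eq_zpow_of_nonzero hne, zpow_le_zpow_iff_right₀ hp1, neg_le_neg_iff] at hnorm
  exact hnorm.trans (Finset.le_sup' (fun i => lamI f γ i p) (Finset.mem_univ i))
end

section
/- Let p be a prime and n an integer with f(n) ≠ 0 and ord_p(f(n)) > 2λ(p). Then there exists a unique index j ∈ {1, …, d} such that ord_p(n − γ_j) = ord_p(f(n)) − λ_j(p). -/
open Polynomial

namespace Polynomial

variable {K : Type*} [Field K] {v : AbsoluteValue K ℝ}

/-- The Gauss norm at radius `1` of a product of linear factors dominates the absolute value of the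
leading coefficient times the product of `max 1 (v (γ i))`. -/
theorem mul_prod_max_le_gaussNorm (hna : IsNonarchimedean v) {ι : Type*} (s : Finset ι)
    (a : K) (γ : ι → K) :
    v a * ∏ i ∈ s, max 1 (v (γ i)) ≤ (C a * ∏ i ∈ s, (X - C (γ i))).gaussNorm v 1 := by
  classical
  induction s using Finset.induction_on with
  | empty => simp
  | insert i s hi ih =>
    have hlin : max 1 (v (γ i)) ≤ (X - C (γ i)).gaussNorm v 1 := by
      refine max_le ?_ ?_
      · have h := (X - C (γ i)).le_gaussNorm v zero_le_one 1
        rwa [coeff_sub, coeff_X_one, coeff_C_of_ne_zero one_ne_zero, sub_zero, map_one, one_pow,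
          one_mul] at h
      · have h := (X - C (γ i)).le_gaussNorm v zero_le_one 0
        rwa [coeff_sub, coeff_X_zero, coeff_C_zero, zero_sub, v.map_neg, pow_zero, mul_one] at h
    rw [Finset.prod_insert hi, Finset.prod_insert hi, mul_left_comm, mul_left_comm (C a),
      gaussNorm_mul hna one_pos]
    refine mul_le_mul hlin ih ?_ ((X - C (γ i)).gaussNorm_nonneg v zero_le_one)
    positivity

/-- The derivative of a product of linear factors at one of its roots. -/
theorem eval_derivative_C_mul_prod_X_sub_C {ι : Type*} [Fintype ι] [DecidableEq ι]
    (a : K) (γ : ι → K) (j : ι) :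
    (derivative (C a * ∏ i, (X - C (γ i)))).eval (γ j) =
      a * ∏ i ∈ Finset.univ.erase j, (γ j - γ i) := by
  rw [← Finset.mul_prod_erase _ _ (Finset.mem_univ j)]
  simp [eval_prod]

/-- At an integral root of a polynomial with integral coefficients, the derivative is no larger
than the distance to any other root. -/
theorem eval_derivative_le_sub (hna : IsNonarchimedean v) {ι : Type*} [Fintype ι]
    {a : K} {γ : ι → K} (hcoeff : ∀ m, v ((C a * ∏ i, (X - C (γ i))).coeff m) ≤ 1)
    {j k : ι} (hj : v (γ j) ≤ 1) (hkj : k ≠ j) :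
    v ((derivative (C a * ∏ i, (X - C (γ i)))).eval (γ j)) ≤ v (γ j - γ k) := by
  classical
  have hgauss : (C a * ∏ i, (X - C (γ i))).gaussNorm v 1 ≤ 1 := by
    obtain ⟨m, hm⟩ := exists_eq_gaussNorm v 1 (C a * ∏ i, (X - C (γ i)))
    simpa [hm] using hcoeff m
  have hprod : v a * ∏ i ∈ (Finset.univ.erase j).erase k, v (γ j - γ i) ≤ 1 := by
    refine le_trans ?_ ((mul_prod_max_le_gaussNorm hna Finset.univ a γ).trans hgauss)
    refine mul_le_mul_of_nonneg_left ?_ (v.nonneg a)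
    calc ∏ i ∈ (Finset.univ.erase j).erase k, v (γ j - γ i)
        ≤ ∏ i ∈ (Finset.univ.erase j).erase k, max 1 (v (γ i)) := by
          refine Finset.prod_le_prod (fun i _ => v.nonneg _) fun i _ => ?_
          have h := hna (γ j) (-γ i)
          rw [← sub_eq_add_neg, v.map_neg] at h
          exact h.trans (max_le_max_right _ hj)
      _ ≤ ∏ i, max 1 (v (γ i)) :=
          Finset.prod_le_prod_of_subset_of_one_le (Finset.subset_univ _)
            (fun i _ => by positivity) fun i _ _ => le_max_left _ _
  rw [eval_derivative_C_mul_prod_X_sub_C, map_mul, map_prod,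
    ← Finset.mul_prod_erase _ _ (Finset.mem_erase.2 ⟨hkj, Finset.mem_univ k⟩), mul_left_comm]
  exact mul_le_of_le_one_right (v.nonneg _) hprod

/-- A form of Hensel's lemma for a completely split polynomial with integral coefficients over a
field with a nonarchimedean absolute value: if `f x` is small compared to the products of the
derivatives at the roots, then there is a unique root `γ j` for which `v (x - γ j)` is
`v (f x) / v (f' (γ j))`. -/
theorem existsUnique_sub_root_mul_derivative_eq (hna : IsNonarchimedean v) {ι : Type*} [Fintype ι]
    [Nonempty ι] {a : K} {γ : ι → K} {f : K[X]} (hf : f = C a * ∏ i, (X - C (γ i)))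
    (hcoeff : ∀ m, v (f.coeff m) ≤ 1) {x : K} (hx : v x ≤ 1) (hfx : v (f.eval x) ≤ 1)
    (hlt : ∀ i k, v (f.eval x) < v (f.derivative.eval (γ i)) * v (f.derivative.eval (γ k))) :
    ∃! j, v (x - γ j) * v (f.derivative.eval (γ j)) = v (f.eval x) := by
  classical
  subst hf
  set f := C a * ∏ i, (X - C (γ i)) with hf
  have hpos (i : ι) : 0 < v (f.derivative.eval (γ i)) :=
    (v.nonneg _).lt_of_ne fun h => ((v.nonneg _).trans_lt (hlt i i)).ne' (by rw [← h, zero_mul])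
  have hsub (y z w : K) : v (y - z) ≤ max (v (w - y)) (v (w - z)) := by
    have h := hna (y - w) (w - z)
    rwa [sub_add_sub_cancel, v.map_sub y w] at h
  obtain ⟨j, hj⟩ := Finite.exists_min fun i => v (x - γ i)
  have heval : v (f.eval x) =
      v (x - γ j) * (v a * ∏ i ∈ Finset.univ.erase j, v (x - γ i)) := by
    rw [hf, ← Finset.mul_prod_erase _ _ (Finset.mem_univ j)]
    simp only [eval_mul, eval_C, eval_sub, eval_X, eval_prod, map_mul, map_prod]
    ring
  have hderiv : v (f.derivative.eval (γ j)) =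
      v a * ∏ i ∈ Finset.univ.erase j, v (γ j - γ i) := by
    rw [hf, eval_derivative_C_mul_prod_X_sub_C, map_mul, map_prod]
  have hle : v (x - γ j) * v (f.derivative.eval (γ j)) ≤ v (f.eval x) := by
    rw [heval, hderiv]
    refine mul_le_mul_of_nonneg_left (mul_le_mul_of_nonneg_left ?_ (v.nonneg _)) (v.nonneg _)
    exact Finset.prod_le_prod (fun i _ => v.nonneg _) fun i _ =>
      (hsub _ _ x).trans (max_le (hj i) le_rfl)
  have hclose : v (x - γ j) < v (f.derivative.eval (γ j)) :=
    lt_of_mul_lt_mul_right (hle.trans_lt (hlt j j)) (v.nonneg _)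
  have hint : v (γ j) ≤ 1 := by
    have hxj : v (x - γ j) ≤ 1 := by
      by_contra! h
      nlinarith
    have h := hna x (γ j - x)
    rw [add_sub_cancel, v.map_sub] at h
    exact h.trans (max_le hx hxj)
  have hsep {k : ι} (hk : k ≠ j) : v (f.derivative.eval (γ j)) ≤ v (γ j - γ k) :=
    eval_derivative_le_sub hna hcoeff hint hk
  refine ⟨j, ?_, fun i hi => ?_⟩
  · dsimp only
    rw [heval, hderiv]
    congr 2
    refine Finset.prod_congr rfl fun k hk => le_antisymm
      ((hsub _ _ x).trans (max_le (hj k) le_rfl)) ?_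
    have h := hna (x - γ j) (γ j - γ k)
    rw [sub_add_sub_cancel] at h
    exact h.trans (max_le (hclose.le.trans (hsep (Finset.ne_of_mem_erase hk))) le_rfl)
  · by_contra hij
    have hi' : v (x - γ i) < v (f.derivative.eval (γ j)) := by
      refine lt_of_mul_lt_mul_right ?_ (hpos i).le
      rw [hi]
      exact hlt j i
    exact absurd ((hsep hij).trans (hsub _ _ x)) (not_le.2 (max_lt hclose hi'))

end Polynomial

/-- a variant of Hensel's lemma. Let `f ∈ ℤ[T]` be separable of degree
`d ≥ 1` with all roots `γ_1, …, γ_d` rational, `p` a prime, and `n` an integer with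
`f(n) ≠ 0` and `ord_p(f(n)) > 2λ(p)`. Then there is a unique index `j` with
`ord_p(n − γ_j) = ord_p(f(n)) − λ_j(p)`. -/
theorem hensel_variant
    (f : Polynomial ℤ) (d : ℕ) (hd : 1 ≤ d) (hdeg : f.natDegree = d) (hf0 : f ≠ 0)
    (hsep : Squarefree (f.map (Int.castRingHom ℚ)))
    (γ : Fin d → ℚ)
    (hfac : f.map (Int.castRingHom ℚ) =
      Polynomial.C ((f.leadingCoeff : ℚ)) * ∏ i : Fin d, (Polynomial.X - Polynomial.C (γ i)))
    (p : ℕ) (hp : p.Prime)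
    (n : ℤ) (hn : f.eval n ≠ 0)
    (hord : 2 * lam f hd γ p < padicValRat p (((f.eval n : ℤ) : ℚ))) :
    ∃! j : Fin d,
      padicValRat p ((n : ℚ) - γ j) = padicValRat p (((f.eval n : ℤ) : ℚ)) - lamI f γ j p := by
  have : Fact p.Prime := ⟨hp⟩
  have : Nonempty (Fin d) := ⟨⟨0, hd⟩⟩
  have hp1 : (1 : ℝ) < p := by exact_mod_cast hp.one_lt
  have hp0 : (0 : ℝ) < p := one_pos.trans hp1
  set v := Rat.AbsoluteValue.padic p with hv
  have hna : IsNonarchimedean v := fun x y => by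
    simp only [hv, Rat.AbsoluteValue.padic_eq_padicNorm]
    exact_mod_cast padicNorm.nonarchimedean
  have hzpow {x : ℚ} (hx : x ≠ 0) : v x = (p : ℝ) ^ (-padicValRat p x) := by
    simp [hv, padicNorm.eq_zpow_of_nonzero hx]
  have hint (m : ℤ) : v m ≤ 1 := Rat.AbsoluteValue.padic_le_one p m
  set g := f.map (Int.castRingHom ℚ) with hg
  have heval : g.eval (n : ℚ) = (f.eval n : ℤ) := by
    simp [hg]
  have heval0 : ((f.eval n : ℤ) : ℚ) ≠ 0 := by exact_mod_cast hn
  have hroot (i : Fin d) : g.eval (γ i) = 0 := by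
    rw [hfac, eval_mul, eval_prod, Finset.prod_eq_zero (Finset.mem_univ i) (by simp), mul_zero]
  have hderiv0 (i : Fin d) : g.derivative.eval (γ i) ≠ 0 :=
    (PerfectField.separable_iff_squarefree.2 hsep).eval₂_derivative_ne_zero (RingHom.id ℚ)
      (hroot i)
  have hsub0 (i : Fin d) : (n : ℚ) - γ i ≠ 0 := fun h => by
    rw [← heval, sub_eq_zero.1 h, hroot] at heval0
    exact heval0 rfl
  have hlam (i : Fin d) : lamI f γ i p ≤ lam f hd γ p :=
    Finset.le_sup' (fun i => lamI f γ i p) (Finset.mem_univ i)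
  have hiff (j : Fin d) : v (n - γ j) * v (g.derivative.eval (γ j)) = v (g.eval (n : ℚ)) ↔
      padicValRat p ((n : ℚ) - γ j) = padicValRat p ((f.eval n : ℤ) : ℚ) - lamI f γ j p := by
    rw [heval, hzpow (hsub0 j), hzpow (hderiv0 j), hzpow heval0, ← zpow_add₀ hp0.ne',
      zpow_right_inj₀ hp0 hp1.ne', lamI]
    constructor <;> intro h <;> linarith
  refine (existsUnique_congr hiff).1
    (existsUnique_sub_root_mul_derivative_eq hna hfac (fun m => ?_) (hint n) ?_ fun i k => ?_)
  · rw [hg, coeff_map]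
    exact hint _
  · rw [heval]
    exact hint _
  · rw [heval, hzpow (hderiv0 i), hzpow (hderiv0 k), hzpow heval0, ← zpow_add₀ hp0.ne',
      zpow_lt_zpow_iff_right₀ hp1]
    have hi := hlam i
    have hk := hlam k
    rw [lamI] at hi hk
    linarith
end

section
/- Let p be a prime and n an integer with f(n) ≠ 0 and ord_p(f(n)) > 2λ(p), and let j ∈ {1, …, d} be an index such that ord_p(n − γ_j) ≥ ord_p(n − γ_i) for all i ∈ {1, …, d}. Then: (i) ord_p(γ_j) ≥ 0 (i.e., γ_j = 0 or ord_p(γ_j) ≥ 0); (ii) ord_p(n − γ_j) > λ_j(p); and (iii) f′(n) ≠ 0 and ord_p(f′(n)) = λ_j(p). -/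
open Polynomial

/-- Comparing `p`-adic norms of nonzero rationals amounts to comparing their valuations. -/
theorem norm_ratCast_le_iff_padicValRat_le {p : ℕ} [Fact p.Prime] {q r : ℚ}
    (hq : q ≠ 0) (hr : r ≠ 0) :
    ‖(q : ℚ_[p])‖ ≤ ‖(r : ℚ_[p])‖ ↔ padicValRat p r ≤ padicValRat p q := by
  have hp : (1 : ℝ) < p := by exact_mod_cast (Fact.out : p.Prime).one_lt
  rw [Padic.norm_eq_zpow_neg_valuation (by exact_mod_cast hq),
    Padic.norm_eq_zpow_neg_valuation (by exact_mod_cast hr), zpow_le_zpow_iff_right₀ hp,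
    Padic.valuation_ratCast, Padic.valuation_ratCast, neg_le_neg_iff]

/-- An integer polynomial is `1`-Lipschitz on the `p`-adically integral rationals. -/
theorem norm_eval_map_sub_eval_map_le {p : ℕ} [Fact p.Prime] (P : Polynomial ℤ) {a b : ℚ}
    (ha : ‖(a : ℚ_[p])‖ ≤ 1) (hb : ‖(b : ℚ_[p])‖ ≤ 1) :
    ‖(((P.map (Int.castRingHom ℚ)).eval a - (P.map (Int.castRingHom ℚ)).eval b : ℚ) : ℚ_[p])‖ ≤
      ‖((a - b : ℚ) : ℚ_[p])‖ := by
  have key : ∀ (x : ℚ) (z : ℤ_[p]), (z : ℚ_[p]) = x →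
      (((P.map (Int.castRingHom ℚ)).eval x : ℚ) : ℚ_[p]) =
        (((P.map (Int.castRingHom ℤ_[p])).eval z : ℤ_[p]) : ℚ_[p]) := by
    intro x z hz
    have h1 := Polynomial.hom_eval₂ P (Int.castRingHom ℚ) (Rat.castHom ℚ_[p]) x
    have h2 := Polynomial.hom_eval₂ P (Int.castRingHom ℤ_[p]) PadicInt.Coe.ringHom z
    rw [Polynomial.eval_map, Polynomial.eval_map]
    refine h1.trans (Eq.trans ?_ h2.symm)
    rw [RingHom.ext_int ((Rat.castHom ℚ_[p]).comp (Int.castRingHom ℚ))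
      (PadicInt.Coe.ringHom.comp (Int.castRingHom ℤ_[p]))]
    exact congrArg (fun t => P.eval₂ _ t) hz.symm
  obtain ⟨y, hy⟩ : ∃ y : ℤ_[p], (y : ℚ_[p]) = a := ⟨⟨a, ha⟩, rfl⟩
  obtain ⟨z, hz⟩ : ∃ z : ℤ_[p], (z : ℚ_[p]) = b := ⟨⟨b, hb⟩, rfl⟩
  obtain ⟨c, hc⟩ := Polynomial.sub_dvd_eval_sub y z (P.map (Int.castRingHom ℤ_[p]))
  rw [Rat.cast_sub, Rat.cast_sub, key a y hy, key b z hz, ← PadicInt.coe_sub, hc, PadicInt.coe_mul,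
    PadicInt.coe_sub, hy, hz, norm_mul]
  exact mul_le_of_le_one_right (norm_nonneg _) c.2

/-- If `x` is at least as close to the root `γ j` as to every other root of
`f = a ∏ (X - γ i)`, then `‖f'(γ j)‖ ‖x - γ j‖ ≤ ‖f(x)‖`. -/
theorem norm_eval_derivative_mul_norm_sub_le {p : ℕ} [Fact p.Prime] {ι : Type*} [Fintype ι]
    [DecidableEq ι] (a : ℚ) (γ : ι → ℚ) (x : ℚ) (j : ι)
    (hj : ∀ i, ‖((x - γ j : ℚ) : ℚ_[p])‖ ≤ ‖((x - γ i : ℚ) : ℚ_[p])‖) :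
    ‖(((C a * ∏ i, (X - C (γ i))).derivative.eval (γ j) : ℚ) : ℚ_[p])‖ *
        ‖((x - γ j : ℚ) : ℚ_[p])‖ ≤
      ‖(((C a * ∏ i, (X - C (γ i))).eval x : ℚ) : ℚ_[p])‖ := by
  rw [← Finset.mul_prod_erase Finset.univ _ (Finset.mem_univ j)]
  have hd : (C a * ((X - C (γ j)) * ∏ i ∈ Finset.univ.erase j, (X - C (γ i)))).derivative.eval
      (γ j) = a * ∏ i ∈ Finset.univ.erase j, (γ j - γ i) := by
    simp [derivative_mul, eval_prod]
  have he : (C a * ((X - C (γ j)) * ∏ i ∈ Finset.univ.erase j, (X - C (γ i)))).eval x =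
      (a * ∏ i ∈ Finset.univ.erase j, (x - γ i)) * (x - γ j) := by
    simp only [eval_mul, eval_C, eval_sub, eval_X, eval_prod]
    ring
  rw [hd, he, Rat.cast_mul (_ * _), norm_mul]
  refine mul_le_mul_of_nonneg_right ?_ (norm_nonneg _)
  rw [Rat.cast_mul, Rat.cast_mul, norm_mul, norm_mul, Rat.cast_prod, Rat.cast_prod, norm_prod,
    norm_prod]
  refine mul_le_mul_of_nonneg_left ?_ (norm_nonneg _)
  refine Finset.prod_le_prod (fun _ _ => norm_nonneg _) fun i _ => ?_
  have h : ((γ j - γ i : ℚ) : ℚ_[p]) = ((x - γ i : ℚ) : ℚ_[p]) - ((x - γ j : ℚ) : ℚ_[p]) := by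
    push_cast
    ring
  rw [h, sub_eq_add_neg]
  exact (Padic.nonarchimedean _ _).trans (max_le le_rfl (by rw [norm_neg]; exact hj i))

/-- Let `f ∈ ℤ[T]` be separable of degree `d ≥ 1` with all roots rational,
`p` a prime, and `n` an integer with `f(n) ≠ 0` and `ord_p(f(n)) > 2λ(p)`. If `j` is an index
maximizing `ord_p(n − γ_j)`, then: (i) `γ_j = 0` or `ord_p(γ_j) ≥ 0`;
(ii) `ord_p(n − γ_j) > λ_j(p)`; (iii) `f'(n) ≠ 0` and `ord_p(f'(n)) = λ_j(p)`. -/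
theorem hensel_variant_aux
    (f : Polynomial ℤ) (d : ℕ) (hd : 1 ≤ d) (hdeg : f.natDegree = d) (hf0 : f ≠ 0)
    (hsep : Squarefree (f.map (Int.castRingHom ℚ)))
    (γ : Fin d → ℚ)
    (hfac : f.map (Int.castRingHom ℚ) =
      Polynomial.C ((f.leadingCoeff : ℚ)) * ∏ i : Fin d, (Polynomial.X - Polynomial.C (γ i)))
    (p : ℕ) (hp : p.Prime)
    (n : ℤ) (hn : f.eval n ≠ 0)
    (hord : 2 * lam f hd γ p < padicValRat p (((f.eval n : ℤ) : ℚ)))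
    (j : Fin d)
    (hj : ∀ i : Fin d, padicValRat p ((n : ℚ) - γ i) ≤ padicValRat p ((n : ℚ) - γ j)) :
    (γ j = 0 ∨ 0 ≤ padicValRat p (γ j)) ∧
      lamI f γ j p < padicValRat p ((n : ℚ) - γ j) ∧
      ((f.map (Int.castRingHom ℚ)).derivative.eval (n : ℚ) ≠ 0 ∧
        padicValRat p ((f.map (Int.castRingHom ℚ)).derivative.eval (n : ℚ)) = lamI f γ j p) := by
  have : Fact p.Prime := ⟨hp⟩
  set F := f.map (Int.castRingHom ℚ) with hF
  have hFn : F.eval (n : ℚ) = ((f.eval n : ℤ) : ℚ) := Polynomial.eval_intCast_map _ _ _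
  have hFn0 : F.eval (n : ℚ) ≠ 0 := by
    rw [hFn]
    exact_mod_cast hn
  have hroot : ∀ i, F.eval (γ i) = 0 := fun i => by
    rw [hfac, eval_mul, eval_prod, Finset.prod_eq_zero (Finset.mem_univ i) (by simp), mul_zero]
  have hne : ∀ i, (n : ℚ) - γ i ≠ 0 := fun i h => hFn0 (by rw [sub_eq_zero.1 h, hroot])
  have hder : F.derivative.eval (γ j) ≠ 0 :=
    (PerfectField.separable_iff_squarefree.2 hsep).eval₂_derivative_ne_zero (RingHom.id ℚ)
      (hroot j)
  have hsum : padicValRat p (F.eval (n : ℚ)) ≤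
      lamI f γ j p + padicValRat p ((n : ℚ) - γ j) := by
    have h := norm_eval_derivative_mul_norm_sub_le (p := p) (f.leadingCoeff : ℚ) γ n j
      fun i => (norm_ratCast_le_iff_padicValRat_le (hne j) (hne i)).2 (hj i)
    rw [← hfac, ← norm_mul, ← Rat.cast_mul,
      norm_ratCast_le_iff_padicValRat_le (mul_ne_zero hder (hne j)) hFn0,
      padicValRat.mul hder (hne j)] at h
    exact h
  have hlam : lamI f γ j p ≤ lam f hd γ p :=
    Finset.le_sup' (fun i => lamI f γ i p) (Finset.mem_univ j)
  have hnonneg : 0 ≤ padicValRat p (F.eval (n : ℚ)) := by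
    rw [hFn, padicValRat.of_int]
    positivity
  rw [← hFn] at hord
  have hlt : lamI f γ j p < padicValRat p ((n : ℚ) - γ j) := by linarith
  have hn1 : ‖((n : ℚ) : ℚ_[p])‖ ≤ 1 := by
    rw [Rat.cast_intCast]
    exact Padic.norm_int_le_one n
  have hsub1 : ‖(((n : ℚ) - γ j : ℚ) : ℚ_[p])‖ ≤ 1 := by
    have h := (norm_ratCast_le_iff_padicValRat_le (p := p) (hne j) one_ne_zero).2
      (by rw [padicValRat.one]; linarith)
    simpa using h
  have hγ1 : ‖(γ j : ℚ_[p])‖ ≤ 1 := by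
    have h : (γ j : ℚ_[p]) = ((n : ℚ) : ℚ_[p]) - (((n : ℚ) - γ j : ℚ) : ℚ_[p]) := by
      push_cast
      ring
    rw [h, sub_eq_add_neg]
    exact (Padic.nonarchimedean _ _).trans (max_le hn1 (by rwa [norm_neg]))
  have hclose : ‖((F.derivative.eval (n : ℚ) : ℚ) : ℚ_[p]) -
      ((F.derivative.eval (γ j) : ℚ) : ℚ_[p])‖ < ‖((F.derivative.eval (γ j) : ℚ) : ℚ_[p])‖ := by
    have h := norm_eval_map_sub_eval_map_le f.derivative hn1 hγ1
    rw [← derivative_map, ← hF, Rat.cast_sub (F.derivative.eval _)] at h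
    refine h.trans_lt (not_le.1 fun h' => ?_)
    exact hlt.not_ge ((norm_ratCast_le_iff_padicValRat_le hder (hne j)).1 h')
  have hnorm := Padic.norm_eq_of_norm_sub_lt_right hclose
  have hdn : F.derivative.eval (n : ℚ) ≠ 0 := by
    intro h
    rw [h, Rat.cast_zero, norm_zero] at hnorm
    exact hder (by exact_mod_cast norm_eq_zero.1 hnorm.symm)
  refine ⟨or_iff_not_imp_left.2 fun h0 => ?_, hlt, hdn, le_antisymm ?_ ?_⟩
  · have h := (norm_ratCast_le_iff_padicValRat_le (p := p) h0 one_ne_zero).1 (by simpa using hγ1)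
    simpa using h
  · exact (norm_ratCast_le_iff_padicValRat_le hder hdn).1 hnorm.ge
  · exact (norm_ratCast_le_iff_padicValRat_le hdn hder).1 hnorm.le
end

section
/- Let S be a finite set of primes containing S₀ and let P be the smallest prime not belonging to S. Then for every integer N ≥ 1, the number of integers n ∈ {1, …, N} such that f(n) ≠ 0 and ord_p(f(n)) ≥ 2 for some prime p ∉ S is at most dN/(P−1) + d(VN+U)^{1/2}. -/
open Polynomial
open scoped Classical

/-- The `p`-adic valuation of a product of nonzero rationals is the sum of the valuations. -/
theorem padicValRat_prod {ι : Type*} {p : ℕ} [Fact p.Prime] (s : Finset ι) (x : ι → ℚ)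
    (hx : ∀ i ∈ s, x i ≠ 0) :
    padicValRat p (∏ i ∈ s, x i) = ∑ i ∈ s, padicValRat p (x i) := by
  induction s using Finset.induction_on with
  | empty => simp
  | insert a s ha ih =>
    have hs : ∀ i ∈ s, x i ≠ 0 := fun i hi => hx i (Finset.mem_insert_of_mem hi)
    rw [Finset.prod_insert ha, Finset.sum_insert ha, padicValRat.mul
      (hx a (Finset.mem_insert_self a s)) (Finset.prod_ne_zero_iff.2 hs), ih hs]

theorem le_padicValRat_sub {p : ℕ} [Fact p.Prime] {x y : ℚ} {k : ℤ} (hxy : x - y ≠ 0)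
    (hx : k ≤ padicValRat p x) (hy : k ≤ padicValRat p y) : k ≤ padicValRat p (x - y) := by
  rw [sub_eq_add_neg] at hxy ⊢
  exact (le_min hx (by rwa [padicValRat.neg])).trans (padicValRat.min_le_padicValRat_add hxy)

theorem padicValRat_sub_nonneg {p : ℕ} [Fact p.Prime] {x y : ℚ}
    (hx : 0 ≤ padicValRat p x) (hy : 0 ≤ padicValRat p y) : 0 ≤ padicValRat p (x - y) := by
  by_cases hxy : x - y = 0
  · simp [hxy]
  · exact le_padicValRat_sub hxy hx hy

theorem not_dvd_den_of_padicValRat_nonneg {p : ℕ} [hp : Fact p.Prime] {x : ℚ}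
    (hx : 0 ≤ padicValRat p x) : ¬ p ∣ x.den := by
  intro hden
  have hnum : ¬ p ∣ x.num.natAbs := fun h =>
    hp.out.one_lt.ne' (Nat.dvd_one.1 (x.reduced ▸ Nat.dvd_gcd h hden))
  have h1 := one_le_padicValNat_of_dvd x.den_nz hden
  have h2 : padicValInt p x.num = 0 := padicValNat.eq_zero_of_not_dvd hnum
  rw [padicValRat_def, h2] at hx
  omega

/-- If a rational `n - x` has `p`-adic valuation at least `k`, then `p ^ k` divides its
numerator over the denominator of `x`. -/
theorem pow_dvd_den_mul_sub_num {p : ℕ} [Fact p.Prime] {x : ℚ} {n k : ℕ}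
    (hne : (n : ℚ) - x ≠ 0) (hk : (k : ℤ) ≤ padicValRat p (n - x)) :
    (p : ℤ) ^ k ∣ x.den * n - x.num := by
  have hden : (x.den : ℚ) ≠ 0 := by exact_mod_cast x.den_nz
  have heq : ((x.den * n - x.num : ℤ) : ℚ) = x.den * (n - x) := by
    push_cast
    rw [mul_sub, Rat.den_mul_eq_num]
  rw [padicValInt_dvd_iff]
  right
  have h := congrArg (padicValRat p) heq
  rw [padicValRat.of_int, padicValRat.mul hden hne, padicValRat.of_nat] at h
  omega

/-- An invertible linear congruence modulo `q` has at most `N / q + 1` solutions in `[1, N]`. -/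
theorem card_filter_dvd_mul_sub_le (N q v : ℕ) (u : ℤ) (hq : 0 < q) (hqv : q.Coprime v) :
    (((Finset.Icc 1 N).filter fun n : ℕ => (q : ℤ) ∣ v * n - u).card : ℝ) ≤ N / q + 1 := by
  rcases ((Finset.Icc 1 N).filter fun n : ℕ => (q : ℤ) ∣ v * n - u).eq_empty_or_nonempty with
    h | ⟨m, hm⟩
  · rw [h]
    simp only [Finset.card_empty, Nat.cast_zero]
    positivity
  have hsub : ((Finset.Icc 1 N).filter fun n : ℕ => (q : ℤ) ∣ v * n - u) ⊆
      (Finset.Ioc 0 N).filter fun n => n ≡ m [MOD q] := by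
    intro n hn
    rw [Finset.mem_filter, Finset.mem_Icc] at hn hm
    rw [Finset.mem_filter, Finset.mem_Ioc]
    refine ⟨by omega, ?_⟩
    have h1 : (q : ℤ) ∣ v * (m - n) := by
      have := dvd_sub hm.2 hn.2
      ring_nf at this ⊢
      exact this
    exact Nat.modEq_iff_dvd.2 (IsCoprime.dvd_of_dvd_mul_left (Nat.isCoprime_iff_coprime.2 hqv) h1)
  have hcard := Nat.Ioc_filter_modEq_card 0 N hq m
  have hle : ((((Finset.Ioc 0 N).filter fun n => n ≡ m [MOD q]).card : ℤ) : ℚ) ≤ N / q + 1 := by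
    rw [hcard, Int.cast_max]
    refine max_le ?_ (by push_cast; positivity)
    rw [Int.cast_sub]
    have h1 := Int.floor_le (((N : ℚ) - m) / q)
    have h2 := Int.lt_floor_add_one ((((0 : ℕ) : ℚ) - m) / q)
    have h3 : (((0 : ℕ) : ℚ) - m) / q = ((N : ℚ) - m) / q - N / q := by
      push_cast
      ring
    linarith
  have hle' : ((((Finset.Ioc 0 N).filter fun n => n ≡ m [MOD q]).card : ℤ) : ℝ) ≤ N / q + 1 := by
    have := (Rat.cast_le (K := ℝ)).2 hle
    push_cast at this ⊢
    exact this
  refine le_trans ?_ hle'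
  exact_mod_cast Finset.card_le_card hsub

/-- A tail of the sum of inverse squares starting at `P` is at most `1 / (P - 1)`. -/
theorem sum_Icc_inv_sq_le {P : ℕ} (hP : 2 ≤ P) (K : ℕ) :
    ∑ m ∈ Finset.Icc P K, ((m : ℝ) ^ 2)⁻¹ ≤ ((P : ℝ) - 1)⁻¹ := by
  have hP' : (2 : ℝ) ≤ P := by exact_mod_cast hP
  rcases le_or_gt P K with h | h
  · have heq : Finset.Icc P K = Finset.Ioc (P - 1) K := by
      ext m
      simp only [Finset.mem_Icc, Finset.mem_Ioc]
      omega
    have := sum_Ioc_inv_sq_le_sub (α := ℝ) (k := P - 1) (n := K) (by omega) (by omega)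
    rw [heq]
    rw [Nat.cast_sub (by omega), Nat.cast_one] at this
    have hK : (0 : ℝ) ≤ (K : ℝ)⁻¹ := by positivity
    linarith
  · rw [Finset.Icc_eq_empty (by omega), Finset.sum_empty]
    exact inv_nonneg.2 (by linarith)

/-- A squarefree product of linear factors over `ℚ` has distinct roots. -/
theorem injective_of_squarefree_prod {d : ℕ} {F : ℚ[X]} {c : ℚ} {γ : Fin d → ℚ}
    (hsep : Squarefree F) (hF : F = C c * ∏ i, (X - C (γ i))) : Function.Injective γ := by
  intro i j hij
  by_contra hne
  refine Polynomial.not_isUnit_X_sub_C (γ i) (hsep _ ?_)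
  rw [hF, ← Finset.mul_prod_erase _ _ (Finset.mem_univ i),
    ← Finset.mul_prod_erase _ _ (Finset.mem_erase.2 ⟨Ne.symm hne, Finset.mem_univ j⟩), ← hij]
  exact ⟨C c * ∏ k ∈ (Finset.univ.erase i).erase j, (X - C (γ k)), by ring⟩

theorem eval_derivative_prod_X_sub_C {d : ℕ} (c : ℚ) (γ : Fin d → ℚ) (i : Fin d) :
    (derivative (C c * ∏ j, (X - C (γ j)))).eval (γ i) =
      c * ∏ j ∈ Finset.univ.erase i, (γ i - γ j) := by
  rw [← Finset.mul_prod_erase _ _ (Finset.mem_univ i)]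
  simp [derivative_mul, eval_prod]

/-- If `c` and the `γ i` are `p`-integral and `c * ∏ (T - γ i)` has derivative of valuation zero
at each `γ i`, then a value of valuation at least `2` at a `p`-integral point `x` comes from
a single factor. -/
theorem exists_two_le_padicValRat_sub {p : ℕ} [Fact p.Prime] {d : ℕ} {c x : ℚ} {γ : Fin d → ℚ}
    (hd : 1 ≤ d) (hγinj : Function.Injective γ) (hc0 : c ≠ 0) (hc : 0 ≤ padicValRat p c)
    (hγ : ∀ i, 0 ≤ padicValRat p (γ i)) (hx : 0 ≤ padicValRat p x)
    (hder : ∀ i, padicValRat p (c * ∏ j ∈ Finset.univ.erase i, (γ i - γ j)) = 0)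
    (hne : ∀ i, x - γ i ≠ 0) (hval : 2 ≤ padicValRat p (c * ∏ i, (x - γ i))) :
    ∃ i, 2 ≤ padicValRat p (x - γ i) := by
  have hdiff : ∀ i, ∀ j ∈ Finset.univ.erase i, γ i - γ j ≠ 0 := fun i j hj =>
    sub_ne_zero.2 (hγinj.ne (Finset.ne_of_mem_erase hj).symm)
  have hsum : ∀ i, padicValRat p c +
      ∑ j ∈ Finset.univ.erase i, padicValRat p (γ i - γ j) = 0 := fun i => by
    rw [← hder i, padicValRat.mul hc0 (Finset.prod_ne_zero_iff.2 (hdiff i)),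
      padicValRat_prod _ _ (hdiff i)]
  have hnonneg : ∀ i j, 0 ≤ padicValRat p (γ i - γ j) := fun i j =>
    padicValRat_sub_nonneg (hγ i) (hγ j)
  have hsum_nonneg : ∀ i, 0 ≤ ∑ j ∈ Finset.univ.erase i, padicValRat p (γ i - γ j) :=
    fun i => Finset.sum_nonneg fun j _ => hnonneg i j
  have hczero : padicValRat p c = 0 := by
    have h1 := hsum ⟨0, hd⟩
    have h2 := hsum_nonneg ⟨0, hd⟩
    omega
  have hzero : ∀ i j, j ≠ i → padicValRat p (γ i - γ j) = 0 := fun i j hji =>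
    (Finset.sum_eq_zero_iff_of_nonneg fun j _ => hnonneg i j).1
      (by have := hsum i; omega) j (Finset.mem_erase.2 ⟨hji, Finset.mem_univ j⟩)
  rw [padicValRat.mul hc0 (Finset.prod_ne_zero_iff.2 fun i _ => hne i),
    padicValRat_prod _ _ fun i _ => hne i, hczero, zero_add] at hval
  have hxnonneg : ∀ i, 0 ≤ padicValRat p (x - γ i) := fun i => padicValRat_sub_nonneg hx (hγ i)
  obtain ⟨i, -, hi⟩ := Finset.exists_lt_of_sum_lt
    (s := Finset.univ) (f := fun _ : Fin d => (0 : ℤ)) (g := fun i => padicValRat p (x - γ i))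
    (by rw [Finset.sum_const_zero]; omega)
  refine ⟨i, ?_⟩
  rwa [Finset.sum_eq_single i _ fun h => absurd (Finset.mem_univ i) h] at hval
  intro j _ hji
  by_contra hj
  have hj1 : 1 ≤ padicValRat p (x - γ j) := by
    have := hxnonneg j
    omega
  have hxx : (x - γ j) - (x - γ i) = γ i - γ j := by ring
  have h := le_padicValRat_sub (x := x - γ j) (y := x - γ i)
    (by rw [hxx]; exact sub_ne_zero.2 (hγinj.ne hji.symm)) hj1 hi
  rw [hxx, hzero i j hji] at h
  omega

/-- Let `f ∈ ℤ[T]` be separable of degree `d ≥ 1` with all roots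
`γ_i = u_i/v_i ∈ ℚ`, `S ⊇ S₀` a finite set of primes and `P` the smallest prime not in `S`.
Then for `N ≥ 1`, the number of `n ∈ {1, …, N}` with `f(n) ≠ 0` and `ord_p(f(n)) ≥ 2` for
some prime `p ∉ S` is at most `dN/(P−1) + d(VN+U)^{1/2}`. -/
theorem count_large_valuation_outside_S
    (f : Polynomial ℤ) (d : ℕ) (hd : 1 ≤ d) (hdeg : f.natDegree = d) (hf0 : f ≠ 0)
    (hsep : Squarefree (f.map (Int.castRingHom ℚ)))
    (γ : Fin d → ℚ)
    (hfac : f.map (Int.castRingHom ℚ) =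
      Polynomial.C ((f.leadingCoeff : ℚ)) * ∏ i : Fin d, (Polynomial.X - Polynomial.C (γ i)))
    (S : Finset ℕ) (hSp : ∀ p ∈ S, Nat.Prime p)
    (hS0 : ∀ p : ℕ, p.Prime → ((∃ i : Fin d, lamI f γ i p ≠ 0) ∨
      (∃ i : Fin d, γ i ≠ 0 ∧ padicValRat p (γ i) ≠ 0)) → p ∈ S)
    (P : ℕ) (hP : P.Prime) (hPS : P ∉ S) (hPmin : ∀ q : ℕ, q.Prime → q ∉ S → P ≤ q)
    (U V : ℕ)
    (hU : U = Finset.univ.sup' ⟨⟨0, hd⟩, Finset.mem_univ _⟩ fun i => (γ i).num.natAbs)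
    (hV : V = Finset.univ.sup' ⟨⟨0, hd⟩, Finset.mem_univ _⟩ fun i => (γ i).den)
    (N : ℕ) (hN : 1 ≤ N) :
    ((((Finset.Icc 1 N).filter fun n : ℕ =>
        f.eval (n : ℤ) ≠ 0 ∧ ∃ p : ℕ, p.Prime ∧ p ∉ S ∧
          2 ≤ padicValInt p (f.eval (n : ℤ))).card : ℝ)) ≤
      (d : ℝ) * N / ((P : ℝ) - 1) + (d : ℝ) * Real.sqrt ((V : ℝ) * N + U) := by
  have hinj := injective_of_squarefree_prod hsep hfac
  have hUi : ∀ i, (γ i).num.natAbs ≤ U := fun i => hU ▸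
    Finset.le_sup' (fun i => (γ i).num.natAbs) (Finset.mem_univ i)
  have hVi : ∀ i, (γ i).den ≤ V := fun i => hV ▸
    Finset.le_sup' (fun i => (γ i).den) (Finset.mem_univ i)
  have heval : ∀ n : ℕ, ((f.eval (n : ℤ) : ℤ) : ℚ) = f.leadingCoeff * ∏ i, ((n : ℚ) - γ i) := by
    intro n
    have h := congrArg (eval (n : ℚ)) hfac
    simpa [eval_prod, eval_intCast_map] using h
  set K := Nat.sqrt (V * N + U) with hK
  let T : Fin d → ℕ → Finset ℕ := fun i m => if m.Prime ∧ m ∉ S then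
    (Finset.Icc 1 N).filter fun n : ℕ => ((m ^ 2 : ℕ) : ℤ) ∣ (γ i).den * n - (γ i).num else ∅
  have hintegral : ∀ p : ℕ, p.Prime → p ∉ S → ∀ i, 0 ≤ padicValRat p (γ i) := by
    intro p hp hpS i
    by_cases h0 : γ i = 0
    · simp [h0]
    · by_contra hneg
      exact hpS (hS0 p hp (Or.inr ⟨i, h0, fun h => hneg h.ge⟩))
  have hsub : ((Finset.Icc 1 N).filter fun n : ℕ =>
      f.eval (n : ℤ) ≠ 0 ∧ ∃ p : ℕ, p.Prime ∧ p ∉ S ∧ 2 ≤ padicValInt p (f.eval (n : ℤ))) ⊆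
      Finset.univ.biUnion fun i => (Finset.Icc P K).biUnion (T i) := by
    intro n hn
    rw [Finset.mem_filter] at hn
    obtain ⟨hnN, hn0, p, hp, hpS, hval⟩ := hn
    have : Fact p.Prime := ⟨hp⟩
    have hfn : (f.leadingCoeff : ℚ) * ∏ i, ((n : ℚ) - γ i) ≠ 0 := by
      rw [← heval n]
      exact_mod_cast hn0
    have hne : ∀ i, (n : ℚ) - γ i ≠ 0 := fun i =>
      Finset.prod_ne_zero_iff.1 (right_ne_zero_of_mul hfn) i (Finset.mem_univ i)
    obtain ⟨i, hi⟩ := exists_two_le_padicValRat_sub (p := p) (x := n) hd hinj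
      (left_ne_zero_of_mul hfn) (by rw [padicValRat.of_int]; positivity)
      (hintegral p hp hpS) (by rw [padicValRat.of_nat]; positivity)
      (fun i => by
        by_contra h
        refine hpS (hS0 p hp (Or.inl ⟨i, ?_⟩))
        rwa [lamI, hfac, eval_derivative_prod_X_sub_C])
      hne (by rw [← heval n, padicValRat.of_int]; exact_mod_cast hval)
    have hdvd : (p : ℤ) ^ 2 ∣ (γ i).den * n - (γ i).num :=
      pow_dvd_den_mul_sub_num (hne i) (by exact_mod_cast hi)
    have hnum0 : ((γ i).den * n - (γ i).num : ℤ) ≠ 0 := by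
      intro h
      apply hne i
      have hden : ((γ i).den : ℚ) ≠ 0 := by exact_mod_cast (γ i).den_nz
      have h' : ((γ i).den * n - (γ i).num : ℚ) = 0 := by exact_mod_cast h
      rw [← Rat.den_mul_eq_num, ← mul_sub] at h'
      exact (mul_eq_zero.1 h').resolve_left hden
    have hpK : p ≤ K := by
      rw [hK, Nat.le_sqrt']
      have h1 := Nat.le_of_dvd (Int.natAbs_pos.2 hnum0) (Int.natAbs_dvd_natAbs.2 hdvd)
      rw [Int.natAbs_pow, Int.natAbs_natCast] at h1
      refine (h1.trans (Int.natAbs_sub_le _ _)).trans (add_le_add ?_ (hUi i))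
      rw [Int.natAbs_mul, Int.natAbs_natCast, Int.natAbs_natCast]
      exact Nat.mul_le_mul (hVi i) (Finset.mem_Icc.1 hnN).2
    simp only [Finset.mem_biUnion, Finset.mem_univ, true_and]
    refine ⟨i, p, Finset.mem_Icc.2 ⟨hPmin p hp hpS, hpK⟩, ?_⟩
    simp only [T, if_pos (And.intro hp hpS), Finset.mem_filter]
    exact ⟨hnN, by exact_mod_cast hdvd⟩
  have hT : ∀ i, ∀ m ∈ Finset.Icc P K, ((T i m).card : ℝ) ≤ N * ((m : ℝ) ^ 2)⁻¹ + 1 := by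
    intro i m _
    by_cases hm : m.Prime ∧ m ∉ S
    · have : Fact m.Prime := ⟨hm.1⟩
      have hcop : (m ^ 2).Coprime (γ i).den := Nat.Coprime.pow_left 2
        (hm.1.coprime_iff_not_dvd.2
          (not_dvd_den_of_padicValRat_nonneg (hintegral m hm.1 hm.2 i)))
      have h := card_filter_dvd_mul_sub_le N (m ^ 2) (γ i).den (γ i).num
        (pow_pos hm.1.pos 2) hcop
      simp only [T, if_pos hm]
      rw [← div_eq_mul_inv]
      push_cast at h ⊢
      exact h
    · simp only [T, if_neg hm, Finset.card_empty, Nat.cast_zero]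
      positivity
  have hKsqrt : (K : ℝ) ≤ Real.sqrt ((V : ℝ) * N + U) := by
    refine Real.le_sqrt_of_sq_le ?_
    exact_mod_cast Nat.sqrt_le' (V * N + U)
  have hcardK : ((Finset.Icc P K).card : ℝ) ≤ K := by
    rw [Nat.card_Icc]
    have := hP.two_le
    exact_mod_cast (by omega : K + 1 - P ≤ K)
  have hi : ∀ i, (((Finset.Icc P K).biUnion (T i)).card : ℝ) ≤
      N * ((P : ℝ) - 1)⁻¹ + Real.sqrt ((V : ℝ) * N + U) := by
    intro i
    calc (((Finset.Icc P K).biUnion (T i)).card : ℝ)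
        ≤ ∑ m ∈ Finset.Icc P K, ((T i m).card : ℝ) := by exact_mod_cast Finset.card_biUnion_le
      _ ≤ ∑ m ∈ Finset.Icc P K, ((N : ℝ) * ((m : ℝ) ^ 2)⁻¹ + 1) := Finset.sum_le_sum (hT i)
      _ = N * ∑ m ∈ Finset.Icc P K, ((m : ℝ) ^ 2)⁻¹ + (Finset.Icc P K).card := by
        rw [Finset.sum_add_distrib, Finset.mul_sum, Finset.sum_const, nsmul_one]
      _ ≤ N * ((P : ℝ) - 1)⁻¹ + Real.sqrt ((V : ℝ) * N + U) :=
        add_le_add (mul_le_mul_of_nonneg_left (sum_Icc_inv_sq_le hP.two_le K) (Nat.cast_nonneg N))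
          (hcardK.trans hKsqrt)
  calc _ ≤ ((Finset.univ.biUnion fun i => (Finset.Icc P K).biUnion (T i)).card : ℝ) := by
        exact_mod_cast Finset.card_le_card hsub
    _ ≤ ∑ i : Fin d, (((Finset.Icc P K).biUnion (T i)).card : ℝ) := by
        exact_mod_cast Finset.card_biUnion_le
    _ ≤ ∑ _i : Fin d, (N * ((P : ℝ) - 1)⁻¹ + Real.sqrt ((V : ℝ) * N + U)) :=
        Finset.sum_le_sum fun i _ => hi i
    _ = _ := by
        rw [Finset.sum_const, Finset.card_univ, Fintype.card_fin, nsmul_eq_mul]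
        ring
end

section
/- Let L ⊆ ℂ be a number field and let A ≥ 1 and E ≥ 1 be integers. For each integer N ≥ 2 let M_N be the subfield of ℂ generated over L by the positive real E-th roots p^{1/E} of all primes p ≤ AN + A. Then there exists a real number c > 0 such that [M_N : ℚ] ≤ exp(cN / log N) for every integer N ≥ 2. -/
open Module IntermediateField

/-- Adjoining one `n`-th root of an element of the base field multiplies the degree by at most
`n`. -/
theorem finrank_adjoin_root_le {F Ω : Type*} [Field F] [Field Ω] [Algebra F Ω]
    {n : ℕ} (hn : 1 ≤ n) {x : Ω} {a : F} (hx : x ^ n = algebraMap F Ω a) :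
    FiniteDimensional F F⟮x⟯ ∧ finrank F F⟮x⟯ ≤ n := by
  have hmonic : (Polynomial.X ^ n - Polynomial.C a).Monic :=
    Polynomial.monic_X_pow_sub_C a (by omega)
  have heval : Polynomial.aeval x (Polynomial.X ^ n - Polynomial.C a) = 0 := by
    simp [hx]
  have hint : IsIntegral F x := ⟨_, hmonic, heval⟩
  refine ⟨adjoin.finiteDimensional hint, ?_⟩
  rw [adjoin.finrank hint]
  simpa [Polynomial.natDegree_X_pow_sub_C] using
    Polynomial.natDegree_le_of_dvd (minpoly.dvd F x heval) hmonic.ne_zero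

/-- Adjoining finitely many `n`-th roots of elements of the base field multiplies the degree by at
most `n` to the number of roots. -/
theorem finrank_sup_adjoin_roots_le {F Ω : Type*} [Field F] [Field Ω] [Algebra F Ω]
    {n : ℕ} (hn : 1 ≤ n) (K : IntermediateField F Ω) [FiniteDimensional F K] (S : Finset Ω)
    (hS : ∀ x ∈ S, ∃ a : F, x ^ n = algebraMap F Ω a) :
    FiniteDimensional F ↥(K ⊔ adjoin F (S : Set Ω)) ∧
      finrank F ↥(K ⊔ adjoin F (S : Set Ω)) ≤ finrank F K * n ^ S.card := by
  classical
  induction S using Finset.induction_on with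
  | empty =>
    rw [Finset.coe_empty, adjoin_empty, sup_bot_eq]
    exact ⟨inferInstance, by simp⟩
  | insert x S hxS ih =>
    obtain ⟨hfin, hle⟩ := ih fun y hy ↦ hS y (Finset.mem_insert_of_mem hy)
    obtain ⟨a, ha⟩ := hS x (Finset.mem_insert_self x S)
    obtain ⟨hfin', hle'⟩ := finrank_adjoin_root_le hn ha
    have hsup : K ⊔ adjoin F ((insert x S : Finset Ω) : Set Ω) =
        (K ⊔ adjoin F (S : Set Ω)) ⊔ F⟮x⟯ := by
      rw [Finset.coe_insert, Set.insert_eq, Set.union_comm, adjoin_union, sup_assoc]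
    rw [hsup, Finset.card_insert_of_notMem hxS]
    refine ⟨inferInstance, ?_⟩
    calc _ ≤ _ := finrank_sup_le _ _
      _ ≤ (finrank F K * n ^ S.card) * n := Nat.mul_le_mul hle hle'
      _ = _ := by ring

/-- Chebyshev's upper bound for the number of primes up to `AN + A`. -/
theorem primeCounting_mul_add_le {A N : ℕ} (hA : 1 ≤ A) (hN : 2 ≤ N) :
    (Nat.primeCounting (A * N + A) : ℝ) ≤
      (2 * Real.log 4 + 2) * (2 * A) * (N / Real.log N) := by
  have hA' : (1 : ℝ) ≤ A := by exact_mod_cast hA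
  have hN' : (2 : ℝ) ≤ N := by exact_mod_cast hN
  obtain ⟨x, hx⟩ : ∃ x : ℝ, x = ((A * N + A : ℕ) : ℝ) := ⟨_, rfl⟩
  have hxe : x = A * N + A := by rw [hx]; push_cast; ring
  have hNx : (N : ℝ) ≤ x := by nlinarith
  have hxle : x ≤ 2 * A * N := by nlinarith
  have hx0 : 0 < x := by linarith
  have hlogN : 0 < Real.log N := Real.log_pos (by linarith)
  have hlog : Real.log N ≤ Real.log x := Real.log_le_log (by linarith) hNx
  have hlogx : 0 < Real.log x := hlogN.trans_le hlog
  have hpi := Chebyshev.pi_le_log4_mul_div (x := x) (by linarith)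
  rw [hx, Nat.floor_natCast, ← hx] at hpi
  have hsqrt : √x ≤ 2 * (x / Real.log x) := by
    have h1 : Real.log √x ≤ √x := Real.log_le_self (Real.sqrt_nonneg x)
    rw [Real.log_sqrt hx0.le] at h1
    rw [← mul_div_assoc, le_div_iff₀ hlogx]
    nlinarith [Real.sq_sqrt hx0.le, Real.sqrt_nonneg x]
  have hlog4 : 0 < Real.log 4 := Real.log_pos (by norm_num)
  calc (Nat.primeCounting (A * N + A) : ℝ)
      ≤ Real.log 4 * x / Real.log √x + √x := hpi
    _ = 2 * Real.log 4 * (x / Real.log x) + √x := by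
        rw [Real.log_sqrt hx0.le]; field_simp
    _ ≤ (2 * Real.log 4 + 2) * (x / Real.log x) := by linarith
    _ ≤ (2 * Real.log 4 + 2) * (2 * A * N / Real.log N) := by gcongr
    _ = _ := by ring

/-- Let `L ⊆ ℂ` be a number field and `A, E ≥ 1` integers. For `N ≥ 2` let
`M_N` be the subfield of `ℂ` generated over `L` by the positive real `E`-th roots `p^{1/E}` of
all primes `p ≤ AN + A`. Then there is `c > 0` such that `[M_N : ℚ] ≤ exp(cN / log N)` for all
`N ≥ 2`. -/
theorem degree_bound_roots_of_primes_field
    (L : Subfield ℂ) (hL : FiniteDimensional ℚ ↥L)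
    (A E : ℕ) (hA : 1 ≤ A) (hE : 1 ≤ E) :
    ∃ c : ℝ, 0 < c ∧ ∀ N : ℕ, 2 ≤ N →
      ∀ M : Subfield ℂ,
        M = Subfield.closure
          (↑L ∪ {z : ℂ | ∃ p : ℕ, p.Prime ∧ p ≤ A * N + A ∧
            z = (((p : ℝ) ^ ((E : ℝ)⁻¹) : ℝ) : ℂ)}) →
        FiniteDimensional ℚ ↥M ∧
          (Module.finrank ℚ ↥M : ℝ) ≤ Real.exp (c * N / Real.log N) := by
  classical
  have hD : 1 ≤ finrank ℚ L := finrank_pos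
  have hD' : (1 : ℝ) ≤ finrank ℚ L := by exact_mod_cast hD
  have hE' : (1 : ℝ) ≤ E := by exact_mod_cast hE
  have hlogD := Real.log_nonneg hD'
  have hlogE := Real.log_nonneg hE'
  have hlog4 : 0 < Real.log 4 := Real.log_pos (by norm_num)
  refine ⟨Real.log (finrank ℚ L) + (2 * Real.log 4 + 2) * (2 * A) * Real.log E + 1,
    by positivity, ?_⟩
  rintro N hN M rfl
  let K : IntermediateField ℚ ℂ := L.toIntermediateField fun q ↦ by simp
  have hK : FiniteDimensional ℚ K := hL
  have hKrank : finrank ℚ K = finrank ℚ L := rfl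
  let S : Finset ℂ := (Nat.primesLE (A * N + A)).image
    fun p : ℕ ↦ (((p : ℝ) ^ ((E : ℝ)⁻¹) : ℝ) : ℂ)
  have hScard : S.card ≤ Nat.primeCounting (A * N + A) := by
    rw [← Nat.primesLE_card_eq_primeCounting]
    exact Finset.card_image_le
  have hS : ∀ x ∈ S, ∃ a : ℚ, x ^ E = algebraMap ℚ ℂ a := by
    intro x hx
    obtain ⟨p, -, rfl⟩ := Finset.mem_image.1 hx
    refine ⟨p, ?_⟩
    rw [← Complex.ofReal_pow, Real.rpow_inv_natCast_pow (by positivity) (by omega)]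
    simp
  obtain ⟨hfin, hle⟩ := finrank_sup_adjoin_roots_le hE K S hS
  have hSset : (S : Set ℂ) = {z : ℂ | ∃ p : ℕ, p.Prime ∧ p ≤ A * N + A ∧
      z = (((p : ℝ) ^ ((E : ℝ)⁻¹) : ℝ) : ℂ)} := by
    ext z
    simp only [S, Finset.coe_image, Set.mem_image, Finset.mem_coe, Nat.mem_primesLE,
      Set.mem_ofPred_eq]
    constructor
    · rintro ⟨p, ⟨h1, h2⟩, rfl⟩
      exact ⟨p, h2, h1, rfl⟩
    · rintro ⟨p, h2, h1, rfl⟩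
      exact ⟨p, ⟨h1, h2⟩, rfl⟩
  rw [← hSset]
  have hM : Subfield.closure ((L : Set ℂ) ∪ S) = (K ⊔ adjoin ℚ (S : Set ℂ)).toSubfield := by
    apply le_antisymm
    · rw [Subfield.closure_le, Set.union_subset_iff]
      exact ⟨(le_sup_left : K ≤ K ⊔ adjoin ℚ (S : Set ℂ)),
        (subset_adjoin ℚ _).trans
          (le_sup_right : adjoin ℚ (S : Set ℂ) ≤ K ⊔ adjoin ℚ (S : Set ℂ))⟩
    · let T : IntermediateField ℚ ℂ :=
        (Subfield.closure ((L : Set ℂ) ∪ S)).toIntermediateField fun q ↦ by simp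
      have hT : K ⊔ adjoin ℚ (S : Set ℂ) ≤ T :=
        sup_le (fun x hx ↦ Subfield.subset_closure (Or.inl hx))
          (adjoin_le_iff.2 fun x hx ↦ Subfield.subset_closure (Or.inr hx))
      exact hT
  rw [hM]
  refine ⟨hfin, ?_⟩
  have hlogN : 0 < Real.log N := Real.log_pos (by exact_mod_cast hN)
  have hquot : 1 ≤ (N : ℝ) / Real.log N :=
    (one_le_div hlogN).2 (Real.log_le_self (Nat.cast_nonneg N))
  have hpi := primeCounting_mul_add_le hA hN
  have hle' : finrank ℚ ↥(K ⊔ adjoin ℚ (S : Set ℂ)) ≤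
      finrank ℚ L * E ^ Nat.primeCounting (A * N + A) :=
    hle.trans (Nat.mul_le_mul hKrank.le (Nat.pow_le_pow_right hE hScard))
  calc (finrank ℚ ↥(K ⊔ adjoin ℚ (S : Set ℂ)) : ℝ)
      ≤ finrank ℚ L * (E : ℝ) ^ Nat.primeCounting (A * N + A) := by exact_mod_cast hle'
    _ = Real.exp (Real.log (finrank ℚ L) +
          Nat.primeCounting (A * N + A) * Real.log E) := by
        rw [Real.exp_add, Real.exp_nat_mul, Real.exp_log (by linarith),
          Real.exp_log (by linarith)]
    _ ≤ _ := by
        rw [Real.exp_le_exp, mul_div_assoc]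
        nlinarith [mul_le_mul_of_nonneg_right hpi hlogE,
          mul_le_mul_of_nonneg_left hquot hlogD]
end
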